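/- Let X be an alphabet, f : X* → ℝ a word function, and let A = (S, σ, δ, Θ) be any weighted automaton over a vector space V over ℝ that computes f, i.e., Θ(δ*(σ, w)) = f(w) for every w ∈ X*. Then the cardinality of the set of derivatives S_f = {f_u | u ∈ X*} is at most the cardinality of S. Consequently, the derivative automaton A_f, whose set of vector states is S_f, is a minimal weighted automaton over a vector space which computes f. -/

import Mathlib

/-- The extension of a transition function `δ : S → X → S` to words (lists of letters). -/
def extTrans {S X : Type*} (δ : S → X → S) (α : S) (u : List X) : S :=
  u.foldl δ α

/-- The derivative `f_u` of a word function `f : X* → ℝ` with respect to a word `u`,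
given by `f_u(w) = f(uw)`. -/
def wordDeriv {X : Type*} (f : List X → ℝ) (u : List X) : List X → ℝ :=
  fun w => f (u ++ w)

universe u v

/-- Reading a concatenation `uw` from a state amounts to reading `u` and then `w`. -/
theorem extTrans_append {S X : Type*} (δ : S → X → S) (α : S) (u w : List X) :
    extTrans δ α (u ++ w) = extTrans δ (extTrans δ α u) w :=
  List.foldl_append

/-- If an automaton computes `f`, every derivative of `f` is the behavior of one of its states. -/
theorem range_wordDeriv_subset {S X : Type*} (δ : S → X → S) (σ : S) (Θ : S → ℝ)
    (f : List X → ℝ) (hf : ∀ w, Θ (extTrans δ σ w) = f w) :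
    Set.range (wordDeriv f) ⊆ Set.range fun (s : S) (w : List X) => Θ (extTrans δ s w) := by
  rintro _ ⟨u, rfl⟩
  refine ⟨extTrans δ σ u, funext fun w => ?_⟩
  rw [wordDeriv, ← hf, extTrans_append]

/-- Let `A = (S, σ, δ, Θ)` be any weighted automaton over a vector
space `V` over `ℝ` that computes the word function `f`.  Then the cardinality of the set
`S_f = {f_u | u ∈ X*}` of derivatives of `f` — the state set of the derivative automaton
`A_f` — is at most the cardinality of `S`; consequently, the derivative automaton `A_f`
is a minimal weighted automaton over a vector space which computes `f`. -/
theorem derivative_automaton_minimal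
    {X : Type u} {V : Type v} [AddCommGroup V] [Module ℝ V]
    (S : Set V) (σ : S) (δ : S → X → S) (Θ : S → ℝ)
    (f : List X → ℝ)
    (hf : ∀ w : List X, Θ (extTrans δ σ w) = f w) :
    Cardinal.lift.{v} (Cardinal.mk (Set.range (wordDeriv f))) ≤
      Cardinal.lift.{u} (Cardinal.mk S) :=
  (Cardinal.lift_le.mpr
    (Cardinal.mk_le_mk_of_subset (range_wordDeriv_subset δ σ Θ f hf))).trans
    Cardinal.mk_range_le_lift
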